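/- arXiv:2111.07697 — 2 statements merged into one kernel-verified Lean document; each statement's English description precedes it below -/
import Mathlib

section
/- Fix real parameters α > 0, β ∈ (0,1), δ ≥ 0, k01, ..., k14 > 0, and assume η = 0. Then every eigenvalue λ ∈ ℂ \ {−1/α} of the generalised boundary-eigenvalue problem satisfies Re λ ≤ 0. -/
/-- `ω₁ = e^{3πi/4}`. -/
noncomputable def ω1 : ℂ := Complex.exp (3 * Real.pi * Complex.I / 4)
/-- `ω₂ = e^{5πi/4}`. -/
noncomputable def ω2 : ℂ := Complex.exp (5 * Real.pi * Complex.I / 4)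

/-- The sector `S = {ρ ∈ ℂ \ {0} : π/8 ≤ arg ρ ≤ π/4}`. -/
def SectorS : Set ℂ := {ρ : ℂ | ρ ≠ 0 ∧ Real.pi / 8 ≤ ρ.arg ∧ ρ.arg ≤ Real.pi / 4}

/-- `λ ≠ −1/α` is an eigenvalue of the generalised boundary-eigenvalue problem if there is a
nonzero four times continuously differentiable `w : [0,1] → ℂ` with
`(1+αλ)w'''' + η w'' + 2λβ√η w' + (δλ + λ²)w = 0` on `[0,1]` and
`w''(0) = (k01 + λk02)w'(0)`, `w'''(0) = −(k03 + λk04)w(0)`,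
`w''(1) = −(k11 + λk12)w'(1)`, `w'''(1) = (k13 + λk14)w(1)`. -/
def IsEigenvalue (α β η δ k01 k02 k03 k04 k11 k12 k13 k14 : ℝ) (lam : ℂ) : Prop :=
  lam ≠ -(1 / α) ∧
  ∃ w : ℝ → ℂ, ContDiff ℝ 4 w ∧ (∃ s ∈ Set.Icc (0 : ℝ) 1, w s ≠ 0) ∧
    (∀ s ∈ Set.Icc (0 : ℝ) 1,
      (1 + α * lam) * iteratedDeriv 4 w s + η * iteratedDeriv 2 w s
        + 2 * lam * β * Real.sqrt η * deriv w s + (δ * lam + lam ^ 2) * w s = 0) ∧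
    iteratedDeriv 2 w 0 = (k01 + lam * k02) * deriv w 0 ∧
    iteratedDeriv 3 w 0 = -(k03 + lam * k04) * w 0 ∧
    iteratedDeriv 2 w 1 = -(k11 + lam * k12) * deriv w 1 ∧
    iteratedDeriv 3 w 1 = (k13 + lam * k14) * w 1

open ComplexConjugate

/-- Integrating by parts twice: the `L²` pairing of `w''''` with `w`. -/
theorem integral_iteratedDeriv_four_mul_conj {w : ℝ → ℂ} (hw : ContDiff ℝ 4 w) (a b : ℝ) :
    ∫ s in a..b, iteratedDeriv 4 w s * conj (w s) =
      (iteratedDeriv 3 w b * conj (w b) - iteratedDeriv 2 w b * conj (deriv w b))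
        - (iteratedDeriv 3 w a * conj (w a) - iteratedDeriv 2 w a * conj (deriv w a))
        + ((∫ s in a..b, ‖iteratedDeriv 2 w s‖ ^ 2 : ℝ) : ℂ) := by
  have hderiv (n : ℕ) (hn : n < 4) (s : ℝ) :
      HasDerivAt (iteratedDeriv n w) (iteratedDeriv (n + 1) w s) s := by
    rw [iteratedDeriv_succ]
    exact (hw.differentiable_iteratedDeriv n (by exact_mod_cast hn)).differentiableAt.hasDerivAt
  have hcont (n : ℕ) (hn : n ≤ 4) : Continuous (iteratedDeriv n w) :=
    hw.continuous_iteratedDeriv n (by exact_mod_cast hn)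
  have hw0 (s : ℝ) : HasDerivAt w (deriv w s) s := by
    simpa using hderiv 0 (by norm_num) s
  have hw1 (s : ℝ) : HasDerivAt (deriv w) (iteratedDeriv 2 w s) s := by
    simpa using hderiv 1 (by norm_num) s
  have hc0 := hw.continuous
  have hc2 := hcont 2 (by norm_num)
  have hc4 := hcont 4 le_rfl
  have hF (s : ℝ) : HasDerivAt
      (fun s => iteratedDeriv 3 w s * conj (w s) - iteratedDeriv 2 w s * conj (deriv w s))
      (iteratedDeriv 4 w s * conj (w s) - ((‖iteratedDeriv 2 w s‖ ^ 2 : ℝ) : ℂ)) s := by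
    have h := ((hderiv 3 (by norm_num) s).mul (hw0 s).star).sub
      ((hderiv 2 (by norm_num) s).mul (hw1 s).star)
    refine h.congr_deriv ?_
    rw [← Complex.normSq_eq_norm_sq, ← Complex.mul_conj]
    simp only [starRingEnd_apply]
    ring
  have hi1 : IntervalIntegrable (fun s => iteratedDeriv 4 w s * conj (w s))
      MeasureTheory.volume a b :=
    (hc4.mul (Complex.continuous_conj.comp hc0)).intervalIntegrable a b
  have hi2 : IntervalIntegrable (fun s => ((‖iteratedDeriv 2 w s‖ ^ 2 : ℝ) : ℂ))
      MeasureTheory.volume a b :=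
    (Complex.continuous_ofReal.comp (hc2.norm.pow 2)).intervalIntegrable a b
  have h := intervalIntegral.integral_eq_sub_of_hasDerivAt (fun s _ => hF s) (hi1.sub hi2)
  rw [intervalIntegral.integral_sub hi1 hi2, intervalIntegral.integral_ofReal] at h
  linear_combination h

/-- A root of a real quadratic with positive leading and nonnegative remaining coefficients
lies in the closed left half-plane. -/
theorem re_nonpos_of_quadratic_eq_zero {a b c : ℝ} (ha : 0 < a) (hb : 0 ≤ b) (hc : 0 ≤ c)
    {z : ℂ} (hz : a * z ^ 2 + b * z + c = 0) : z.re ≤ 0 := by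
  by_contra! hx
  have hre := congrArg Complex.re hz
  have him := congrArg Complex.im hz
  simp [pow_two] at hre him
  have hy : z.im * (2 * a * z.re + b) = 0 := by linear_combination him
  rcases mul_eq_zero.mp hy with hy | hy
  · rw [hy] at hre
    have : 0 < a * (z.re * z.re) := by positivity
    have : 0 ≤ b * z.re := by positivity
    linarith
  · have : 0 < a * z.re := by positivity
    linarith

/-- when `η = 0`, every eigenvalue of the generalised boundary-eigenvalue
problem lies in the closed left half-plane. -/
theorem eigenvalues_left_halfplane_of_eta_zero (α β η δ k01 k02 k03 k04 k11 k12 k13 k14 : ℝ)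
    (hα : 0 < α) (hβ0 : 0 < β) (hβ1 : β < 1) (hδ : 0 ≤ δ) (hη : η = 0)
    (h01 : 0 < k01) (h02 : 0 < k02) (h03 : 0 < k03) (h04 : 0 < k04)
    (h11 : 0 < k11) (h12 : 0 < k12) (h13 : 0 < k13) (h14 : 0 < k14)
    (lam : ℂ)
    (h : IsEigenvalue α β η δ k01 k02 k03 k04 k11 k12 k13 k14 lam) :
    lam.re ≤ 0 := by
  subst hη
  obtain ⟨-, w, hw, ⟨t, ht, hwt⟩, hode, hb1, hb2, hb3, hb4⟩ := h
  have hC : 0 < ∫ s in (0 : ℝ)..1, ‖w s‖ ^ 2 :=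
    intervalIntegral.integral_pos one_pos (hw.continuous.norm.pow 2).continuousOn
      (fun s _ => by positivity) ⟨t, ht, by positivity⟩
  have hD : 0 ≤ ∫ s in (0 : ℝ)..1, ‖iteratedDeriv 2 w s‖ ^ 2 :=
    intervalIntegral.integral_nonneg zero_le_one (fun s _ => by positivity)
  have hpair : (1 + α * lam) * (∫ s in (0 : ℝ)..1, iteratedDeriv 4 w s * conj (w s))
      = -(δ * lam + lam ^ 2) * ((∫ s in (0 : ℝ)..1, ‖w s‖ ^ 2 : ℝ) : ℂ) := by
    rw [← intervalIntegral.integral_ofReal, ← intervalIntegral.integral_const_mul,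
      ← intervalIntegral.integral_const_mul]
    refine intervalIntegral.integral_congr fun s hs => ?_
    rw [Set.uIcc_of_le zero_le_one] at hs
    have h := hode s hs
    simp only [Real.sqrt_zero, Complex.ofReal_zero, zero_mul, mul_zero, add_zero] at h
    simp only [← Complex.normSq_eq_norm_sq, ← Complex.mul_conj]
    linear_combination conj (w s) * h
  rw [integral_iteratedDeriv_four_mul_conj hw, hb1, hb2, hb3, hb4] at hpair
  set C := ∫ s in (0 : ℝ)..1, ‖w s‖ ^ 2
  set D := ∫ s in (0 : ℝ)..1, ‖iteratedDeriv 2 w s‖ ^ 2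
  have hnorm (z : ℂ) : z * conj z = ((‖z‖ ^ 2 : ℝ) : ℂ) := by
    rw [Complex.mul_conj, Complex.normSq_eq_norm_sq]
  set A := D + k01 * ‖deriv w 0‖ ^ 2 + k03 * ‖w 0‖ ^ 2 + k11 * ‖deriv w 1‖ ^ 2
    + k13 * ‖w 1‖ ^ 2 with hA
  set B := k02 * ‖deriv w 0‖ ^ 2 + k04 * ‖w 0‖ ^ 2 + k12 * ‖deriv w 1‖ ^ 2
    + k14 * ‖w 1‖ ^ 2 with hB
  have hA0 : 0 ≤ A := by positivity
  have hB0 : 0 ≤ B := by positivity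
  refine re_nonpos_of_quadratic_eq_zero (a := α * B + C) (b := α * A + B + δ * C) (c := A)
    (by positivity) (by positivity) hA0 ?_
  have hAB : (A : ℂ) + lam * B = D + (k01 + lam * k02) * (deriv w 0 * conj (deriv w 0))
      + (k03 + lam * k04) * (w 0 * conj (w 0))
      + (k11 + lam * k12) * (deriv w 1 * conj (deriv w 1))
      + (k13 + lam * k14) * (w 1 * conj (w 1)) := by
    simp only [hnorm, hA, hB]
    push_cast
    ring
  push_cast
  linear_combination hpair + (1 + α * lam) * hAB
end

section
/- Fix real parameters α > 0, β ∈ (0,1), δ ≥ 0, k01, ..., k14 > 0, and assume η > 0. Then the set of eigenvalues λ ∈ ℂ \ {−1/α} of the generalised boundary-eigenvalue problem with Re λ > 0 is finite. -/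
open MeasureTheory ComplexConjugate

theorem norm_intervalIntegral_mul_conj_le {f g : ℝ → ℂ} (hf : Continuous f) (hg : Continuous g)
    {ε : ℝ} (hε : 0 < ε) :
    2 * ‖∫ s in (0 : ℝ)..1, f s * conj (g s)‖ ≤
      ε * (∫ s in (0 : ℝ)..1, ‖f s‖ ^ 2) + (∫ s in (0 : ℝ)..1, ‖g s‖ ^ 2) / ε := by
  have h1 : ‖∫ s in (0 : ℝ)..1, f s * conj (g s)‖ ≤
      ∫ s in (0 : ℝ)..1, (ε / 2 * ‖f s‖ ^ 2 + 1 / (2 * ε) * ‖g s‖ ^ 2) := by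
    refine (intervalIntegral.norm_integral_le_integral_norm zero_le_one).trans ?_
    refine intervalIntegral.integral_mono_on zero_le_one ?_ ?_ ?_
    · exact Continuous.intervalIntegrable (by fun_prop) _ _
    · exact Continuous.intervalIntegrable (by fun_prop) _ _
    · intro s _
      rw [norm_mul, RCLike.norm_conj]
      have : ε / 2 * ‖f s‖ ^ 2 + 1 / (2 * ε) * ‖g s‖ ^ 2 - ‖f s‖ * ‖g s‖
          = (ε * ‖f s‖ - ‖g s‖) ^ 2 / (2 * ε) := by
        field_simp
        ring
      have : 0 ≤ (ε * ‖f s‖ - ‖g s‖) ^ 2 / (2 * ε) := by positivity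
      linarith
  rw [intervalIntegral.integral_add, intervalIntegral.integral_const_mul,
    intervalIntegral.integral_const_mul] at h1
  · calc _ ≤ 2 * _ := mul_le_mul_of_nonneg_left h1 zero_le_two
      _ = _ := by field_simp
  · exact Continuous.intervalIntegrable (by fun_prop) _ _
  · exact Continuous.intervalIntegrable (by fun_prop) _ _

theorem sq_intervalIntegral_le {f : ℝ → ℝ} (hf : Continuous f) :
    (∫ s in (0 : ℝ)..1, f s) ^ 2 ≤ ∫ s in (0 : ℝ)..1, f s ^ 2 := by
  set c := ∫ s in (0 : ℝ)..1, f s with hc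
  have h : 0 ≤ ∫ s in (0 : ℝ)..1, (f s ^ 2 - (2 * c) * f s + c ^ 2) := by
    refine intervalIntegral.integral_nonneg zero_le_one fun s _ => ?_
    nlinarith [sq_nonneg (f s - c)]
  rw [intervalIntegral.integral_add, intervalIntegral.integral_sub,
    intervalIntegral.integral_const_mul, ← hc] at h
  · simp at h
    nlinarith
  all_goals exact Continuous.intervalIntegrable (by fun_prop) _ _

theorem intervalIntegral_sq_norm_le {f f' : ℝ → ℂ} (hf : ∀ s, HasDerivAt f (f' s) s)
    (hf' : Continuous f') :
    ∫ s in (0 : ℝ)..1, ‖f s‖ ^ 2 ≤ 2 * ‖f 0‖ ^ 2 + 2 * ∫ s in (0 : ℝ)..1, ‖f' s‖ ^ 2 := by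
  have hfc : Continuous f := continuous_iff_continuousAt.2 fun s => (hf s).continuousAt
  have key : ∀ s ∈ Set.Icc (0 : ℝ) 1,
      ‖f s‖ ^ 2 ≤ 2 * ‖f 0‖ ^ 2 + 2 * ∫ s in (0 : ℝ)..1, ‖f' s‖ ^ 2 := by
    intro s hs
    have h1 : ∫ t in (0 : ℝ)..s, f' t = f s - f 0 :=
      intervalIntegral.integral_eq_sub_of_hasDerivAt (fun t _ => hf t)
        (hf'.intervalIntegrable _ _)
    have h2 : ‖f s - f 0‖ ≤ ∫ t in (0 : ℝ)..1, ‖f' t‖ := by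
      rw [← h1]
      refine (intervalIntegral.norm_integral_le_integral_norm hs.1).trans ?_
      exact intervalIntegral.integral_mono_interval le_rfl hs.1 hs.2
        (Filter.Eventually.of_forall fun t => norm_nonneg _)
        (hf'.norm.intervalIntegrable _ _)
    have h3 := sq_intervalIntegral_le hf'.norm
    have h4 : ‖f s‖ ≤ ‖f 0‖ + ‖f s - f 0‖ := norm_le_norm_add_norm_sub' _ _
    have h5 := norm_nonneg (f s)
    have h6 := norm_nonneg (f s - f 0)
    nlinarith [sq_nonneg (‖f 0‖ - ‖f s - f 0‖)]
  have h := intervalIntegral.integral_mono_on (μ := volume) zero_le_one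
    (Continuous.intervalIntegrable (by fun_prop) _ _)
    (Continuous.intervalIntegrable continuous_const _ _) key
  rwa [intervalIntegral.integral_const, sub_zero, one_smul] at h

set_option maxHeartbeats 1000000 in
/-- The algebraic core of the energy estimate. -/
theorem exists_bound_of_energy_inequalities {α η δ b C : ℝ} (hα : 0 < α) (hη : 0 < η) (hδ : 0 ≤ δ)
    (hb : 0 < b) (hC : 0 < C) :
    ∃ R : ℝ, ∀ (lam W1 W2 : ℂ) (I0 I1 I2 P Q : ℝ), 0 ≤ I0 → 0 ≤ I2 → 0 ≤ P → 0 ≤ Q →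
      I1 ≤ C * (I2 + P) →
      (∀ ε : ℝ, 0 < ε → 2 * ‖W1‖ ≤ ε * I1 + I0 / ε) → 2 * ‖W2‖ ≤ I2 + I0 →
      (1 + α * lam) * ((I2 : ℂ) + P + lam * Q) + η * W2 + 2 * lam * b * W1
        + (δ * lam + lam ^ 2) * I0 = 0 →
      0 < lam.re → R < ‖lam‖ → I0 = 0 := by
  set e : ℝ := α / (2 * b * C) with he
  have hepos : 0 < e := by positivity
  set C2 : ℝ := b / e with hC2
  have hC2pos : 0 < C2 := by positivity
  set C3 : ℝ := 1 + α + 1 / α + δ + η / 2 + α / 2 + C2 with hC3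
  have hC3pos : 0 < C3 := by positivity
  set C4 : ℝ := η / 2 + C2 * C3 + C3 with hC4
  have hC4pos : 0 < C4 := by positivity
  refine ⟨1 + C4 * (2 / α + 1), ?_⟩
  intro lam W1 W2 I0 I1 I2 P Q hI0 hI2 hP hQ hI1 hW1 hW2 heq hre hR
  have hlam : lam ≠ 0 := by
    rintro rfl
    simp at hre
  set L := ‖lam‖ with hL
  have hL1 : 1 < L := by
    have : 0 ≤ C4 * (2 / α + 1) := by positivity
    linarith
  set N := I2 + P with hN
  set M := I0 + α * Q with hM
  have hNnn : 0 ≤ N := by positivity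
  have hMnn : 0 ≤ M := by positivity
  have hQα : 0 ≤ α * Q := by positivity
  have hI0M : I0 ≤ M := by linarith
  have hQM : Q ≤ 1 / α * M := by
    have : 1 / α * M = I0 / α + Q := by rw [hM]; field_simp
    have : 0 ≤ I0 / α := by positivity
    linarith
  have hW1' : 2 * b * ‖W1‖ ≤ α / 2 * N + C2 * M := by
    have h := hW1 e hepos
    have h1 : b * (2 * ‖W1‖) ≤ b * (e * (C * N) + M / e) := by
      gcongr
      refine h.trans ?_
      gcongr
    have h2 : b * (e * (C * N) + M / e) = α / 2 * N + C2 * M := by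
      rw [hC2]
      have : b * (e * (C * N)) = α / 2 * N := by
        rw [he]; field_simp
      rw [mul_add, this]; ring
    linarith
  have hW2' : ‖W2‖ ≤ (N + M) / 2 := by linarith
  have hdiv : lam⁻¹ * N + α * N + Q + lam * M + δ * I0 + (η * lam⁻¹ * W2 + 2 * b * W1) = 0 := by
    have : lam⁻¹ * N + α * N + Q + lam * M + δ * I0 + (η * lam⁻¹ * W2 + 2 * b * W1)
      = lam⁻¹ * ((1 + α * lam) * ((I2 : ℂ) + P + lam * Q) + η * W2 + 2 * lam * b * W1
        + (δ * lam + lam ^ 2) * I0) := by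
      rw [hN, hM]; push_cast; field_simp; ring
    rw [this, heq, mul_zero]
  have hZ : ‖η * lam⁻¹ * W2 + 2 * b * W1‖ ≤ η / L * ((N + M) / 2) + (α / 2 * N + C2 * M) := by
    refine (norm_add_le _ _).trans ?_
    have h1 : ‖(η : ℂ) * lam⁻¹ * W2‖ = η / L * ‖W2‖ := by
      rw [norm_mul, norm_mul, norm_inv, Complex.norm_of_nonneg hη.le]; rfl
    have h2 : ‖2 * (b : ℂ) * W1‖ = 2 * b * ‖W1‖ := by
      rw [norm_mul, norm_mul, Complex.norm_of_nonneg hb.le]; simp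
    rw [h1, h2]
    gcongr
  set Z := (η : ℂ) * lam⁻¹ * W2 + 2 * b * W1 with hZdef
  have hinv : 0 ≤ (lam⁻¹).re := by
    rw [Complex.inv_re]; exact div_nonneg hre.le (Complex.normSq_nonneg _)
  have hreal : α * N ≤ ‖Z‖ := by
    have h := congrArg Complex.re hdiv
    simp only [Complex.add_re, Complex.re_mul_ofReal, Complex.zero_re, ← Complex.ofReal_mul,
      Complex.ofReal_re] at h
    have h1 := Complex.abs_re_le_norm Z
    have h2 := neg_abs_le Z.re
    have h3 : 0 ≤ (lam⁻¹).re * N := by positivity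
    have h4 : 0 ≤ lam.re * M := by positivity
    have h5 : 0 ≤ δ * I0 := by positivity
    linarith
  have hnorm : L * M ≤ 1 / L * N + α * N + Q + δ * I0 + ‖Z‖ := by
    have h : lam * M = -(lam⁻¹ * N + α * N + Q + δ * I0 + Z) := by
      linear_combination hdiv
    have h1 : ‖lam * M‖ = L * M := by rw [norm_mul, Complex.norm_of_nonneg hMnn]
    rw [← h1, h, norm_neg]
    have n1 := norm_add_le (lam⁻¹ * N + α * N + Q + δ * I0) Z
    have n2 := norm_add_le (lam⁻¹ * N + α * N + Q) ((δ : ℂ) * I0)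
    have n3 := norm_add_le (lam⁻¹ * N + α * N) (Q : ℂ)
    have n4 := norm_add_le (lam⁻¹ * N) ((α : ℂ) * N)
    have e1 : ‖lam⁻¹ * N‖ = 1 / L * N := by
      rw [norm_mul, norm_inv, Complex.norm_of_nonneg hNnn, one_div]
    have e2 : ‖(α : ℂ) * N‖ = α * N := by
      rw [norm_mul, Complex.norm_of_nonneg hα.le, Complex.norm_of_nonneg hNnn]
    have e3 : ‖(Q : ℂ)‖ = Q := Complex.norm_of_nonneg hQ
    have e4 : ‖(δ : ℂ) * I0‖ = δ * I0 := by
      rw [norm_mul, Complex.norm_of_nonneg hδ, Complex.norm_of_nonneg hI0]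
    linarith
  have hηL : η / L ≤ η := div_le_self hη.le hL1.le
  have h1L : 1 / L ≤ 1 := by rw [div_le_one (by linarith)]; exact hL1.le
  have hii : L * M ≤ C3 * (N + M) := by
    have h1 : η / L * ((N + M) / 2) ≤ η * ((N + M) / 2) := by gcongr
    have h2 : 1 / L * N ≤ 1 * N := by gcongr
    have h3 : δ * I0 ≤ δ * M := by gcongr
    have h4 : C3 * (N + M) - (1 * N + α * N + 1 / α * M + δ * M
        + (η * ((N + M) / 2) + (α / 2 * N + C2 * M)))
        = M + α * M + 1 / α * N + δ * N + α / 2 * M + C2 * N := by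
      rw [hC3]; ring
    have h5 : 0 ≤ M + α * M + 1 / α * N + δ * N + α / 2 * M + C2 * N := by positivity
    linarith
  have hi : L * (α / 2 * N) ≤ (η / 2 + C2 * C3) * (N + M) := by
    have h1 : L * (α / 2 * N) ≤ L * (η / L * ((N + M) / 2) + C2 * M) := by
      gcongr; linarith
    have h2 : L * (η / L * ((N + M) / 2) + C2 * M) = η / 2 * (N + M) + C2 * (L * M) := by
      field_simp
    have h3 : C2 * (L * M) ≤ C2 * (C3 * (N + M)) := by gcongr
    linarith
  have hsum : L * (α / 2 * N + M) ≤ C4 * (N + M) := by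
    rw [hC4]; linarith
  have hK : N + M ≤ (2 / α + 1) * (α / 2 * N + M) := by
    have : (2 / α + 1) * (α / 2 * N + M) = N + M + (α / 2 * N + 2 / α * M) := by
      field_simp; ring
    have : 0 ≤ α / 2 * N + 2 / α * M := by positivity
    linarith
  have hX : 0 ≤ α / 2 * N + M := by positivity
  have hfin : L * (α / 2 * N + M) ≤ C4 * (2 / α + 1) * (α / 2 * N + M) := by
    refine hsum.trans ?_
    rw [mul_assoc]
    gcongr
  have hX0 : α / 2 * N + M ≤ 0 := by
    by_contra! hpos
    have := le_of_mul_le_mul_right hfin hpos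
    linarith
  have : 0 ≤ α / 2 * N := by positivity
  linarith

theorem intervalIntegral_mul_conj_self {f : ℝ → ℂ} :
    ∫ s in (0 : ℝ)..1, f s * conj (f s) = ((∫ s in (0 : ℝ)..1, ‖f s‖ ^ 2 : ℝ) : ℂ) := by
  rw [← intervalIntegral.integral_ofReal]
  refine intervalIntegral.integral_congr fun s _ => ?_
  simp [Complex.mul_conj']

theorem HasDerivAt.complex_conj {f : ℝ → ℂ} {f' : ℂ} {s : ℝ} (h : HasDerivAt f f' s) :
    HasDerivAt (fun t => conj (f t)) (conj f') s :=
  h.star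

/-- Twofold integration by parts of `w'''' w̄`. -/
theorem intervalIntegral_fourth_deriv_mul_conj {w0 w1 w2 w3 w4 : ℝ → ℂ}
    (h0 : ∀ s, HasDerivAt w0 (w1 s) s) (h1 : ∀ s, HasDerivAt w1 (w2 s) s)
    (h2 : ∀ s, HasDerivAt w2 (w3 s) s) (h3 : ∀ s, HasDerivAt w3 (w4 s) s)
    (h4 : Continuous w4) :
    ∫ s in (0 : ℝ)..1, w4 s * conj (w0 s) =
      (w3 1 * conj (w0 1) - w2 1 * conj (w1 1)) - (w3 0 * conj (w0 0) - w2 0 * conj (w1 0))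
        + ∫ s in (0 : ℝ)..1, w2 s * conj (w2 s) := by
  have c0 : Continuous w0 := continuous_iff_continuousAt.2 fun s => (h0 s).continuousAt
  have c2 : Continuous w2 := continuous_iff_continuousAt.2 fun s => (h2 s).continuousAt
  have c0' : Continuous fun s => conj (w0 s) := Complex.continuous_conj.comp c0
  have c2' : Continuous fun s => conj (w2 s) := Complex.continuous_conj.comp c2
  have hd : ∀ s, HasDerivAt (fun s => w3 s * conj (w0 s) - w2 s * conj (w1 s))
      (w4 s * conj (w0 s) - w2 s * conj (w2 s)) s := by
    intro s
    exact (((h3 s).mul (h0 s).complex_conj).sub ((h2 s).mul (h1 s).complex_conj)).congr_deriv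
      (by ring)
  have h := intervalIntegral.integral_eq_sub_of_hasDerivAt (a := 0) (b := 1)
    (fun s _ => hd s) (Continuous.intervalIntegrable (by fun_prop) _ _)
  rw [intervalIntegral.integral_sub (Continuous.intervalIntegrable (by fun_prop) _ _)
    (Continuous.intervalIntegrable (by fun_prop) _ _)] at h
  linear_combination h

theorem exists_norm_le_of_isEigenvalue {α β η δ k01 k02 k03 k04 k11 k12 k13 k14 : ℝ}
    (hα : 0 < α) (hβ : 0 < β) (hδ : 0 ≤ δ) (hη : 0 < η)
    (h01 : 0 < k01) (h02 : 0 ≤ k02) (h03 : 0 ≤ k03) (h04 : 0 ≤ k04)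
    (h11 : 0 ≤ k11) (h12 : 0 ≤ k12) (h13 : 0 ≤ k13) (h14 : 0 ≤ k14) :
    ∃ R : ℝ, ∀ lam : ℂ, IsEigenvalue α β η δ k01 k02 k03 k04 k11 k12 k13 k14 lam →
      0 < lam.re → ‖lam‖ ≤ R := by
  obtain ⟨R, hR⟩ := exists_bound_of_energy_inequalities (b := β * √η) (C := 2 + 2 / k01)
    hα hη hδ (by positivity) (by positivity)
  refine ⟨R, fun lam hlam hre => ?_⟩
  by_contra! hlt
  obtain ⟨-, w, hw, ⟨s₀, hs₀, hne⟩, hode, hb1, hb2, hb3, hb4⟩ := hlam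
  have hd : ∀ n : ℕ, n < 4 → ∀ s, HasDerivAt (iteratedDeriv n w) (iteratedDeriv (n + 1) w s) s := by
    intro n hn s
    rw [iteratedDeriv_succ]
    exact (hw.differentiable_iteratedDeriv n (by exact_mod_cast hn) s).hasDerivAt
  have hc : ∀ n : ℕ, n ≤ 4 → Continuous (iteratedDeriv n w) := fun n hn =>
    hw.continuous_iteratedDeriv n (by exact_mod_cast hn)
  rw [← iteratedDeriv_one] at hode hb1 hb3
  rw [← iteratedDeriv_zero (f := w)] at hne
  have hb2' : iteratedDeriv 3 w 0 = -(k03 + lam * k04) * iteratedDeriv 0 w 0 := by simpa using hb2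
  have hb4' : iteratedDeriv 3 w 1 = (k13 + lam * k14) * iteratedDeriv 0 w 1 := by simpa using hb4
  have hode' : ∀ s ∈ Set.Icc (0 : ℝ) 1,
      (1 + α * lam) * iteratedDeriv 4 w s + η * iteratedDeriv 2 w s
        + 2 * lam * β * Real.sqrt η * iteratedDeriv 1 w s
        + (δ * lam + lam ^ 2) * iteratedDeriv 0 w s = 0 := by simpa using hode
  clear hode hb2 hb4
  set w0 := iteratedDeriv 0 w
  set w1 := iteratedDeriv 1 w
  set w2 := iteratedDeriv 2 w
  set w3 := iteratedDeriv 3 w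
  set w4 := iteratedDeriv 4 w
  have c0 : Continuous w0 := hc 0 (by norm_num)
  have c1 : Continuous w1 := hc 1 (by norm_num)
  have c2 : Continuous w2 := hc 2 (by norm_num)
  have c4 : Continuous w4 := hc 4 (by norm_num)
  have c0' : Continuous fun s => conj (w0 s) := Complex.continuous_conj.comp c0
  have hparts := intervalIntegral_fourth_deriv_mul_conj (w0 := w0) (w1 := w1) (w2 := w2) (w3 := w3)
    (hd 0 (by norm_num)) (hd 1 (by norm_num)) (hd 2 (by norm_num)) (hd 3 (by norm_num)) c4
  rw [intervalIntegral_mul_conj_self] at hparts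
  have hzero := hR lam (∫ s in (0 : ℝ)..1, w1 s * conj (w0 s)) (∫ s in (0 : ℝ)..1, w2 s * conj (w0 s))
    (∫ s in (0 : ℝ)..1, ‖w0 s‖ ^ 2) (∫ s in (0 : ℝ)..1, ‖w1 s‖ ^ 2) (∫ s in (0 : ℝ)..1, ‖w2 s‖ ^ 2)
    (k01 * ‖w1 0‖ ^ 2 + k03 * ‖w0 0‖ ^ 2 + k11 * ‖w1 1‖ ^ 2 + k13 * ‖w0 1‖ ^ 2)
    (k02 * ‖w1 0‖ ^ 2 + k04 * ‖w0 0‖ ^ 2 + k12 * ‖w1 1‖ ^ 2 + k14 * ‖w0 1‖ ^ 2)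
    (intervalIntegral.integral_nonneg zero_le_one fun s _ => by positivity)
    (intervalIntegral.integral_nonneg zero_le_one fun s _ => by positivity)
    (by positivity) (by positivity)
    (by
      have h := intervalIntegral_sq_norm_le (hd 1 (by norm_num)) c2
      have h2 : 0 ≤ ∫ s in (0 : ℝ)..1, ‖w2 s‖ ^ 2 :=
        intervalIntegral.integral_nonneg zero_le_one fun s _ => by positivity
      refine h.trans ?_
      have e : 2 / k01 * (k01 * ‖w1 0‖ ^ 2) = 2 * ‖w1 0‖ ^ 2 := by field_simp
      have p1 : 0 ≤ 2 / k01 * (∫ s in (0 : ℝ)..1, ‖w2 s‖ ^ 2) := by positivity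
      have p2 : 0 ≤ 2 / k01 * (k03 * ‖w0 0‖ ^ 2 + k11 * ‖w1 1‖ ^ 2 + k13 * ‖w0 1‖ ^ 2) := by
        positivity
      have p3 : 0 ≤ 2 * (k01 * ‖w1 0‖ ^ 2 + k03 * ‖w0 0‖ ^ 2 + k11 * ‖w1 1‖ ^ 2
        + k13 * ‖w0 1‖ ^ 2) := by positivity
      linarith)
    (fun ε hε => norm_intervalIntegral_mul_conj_le c1 c0 hε)
    (by simpa using norm_intervalIntegral_mul_conj_le c2 c0 one_pos)
    (by
      have hint : ∫ s in (0 : ℝ)..1, ((1 + α * lam) * (w4 s * conj (w0 s))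
          + η * (w2 s * conj (w0 s)) + 2 * lam * β * √η * (w1 s * conj (w0 s))
          + (δ * lam + lam ^ 2) * (w0 s * conj (w0 s))) = 0 := by
        rw [intervalIntegral.integral_congr (g := fun _ => (0 : ℂ)), intervalIntegral.integral_zero]
        intro s hs
        rw [Set.uIcc_of_le zero_le_one] at hs
        linear_combination conj (w0 s) * hode' s hs
      rw [intervalIntegral.integral_add, intervalIntegral.integral_add,
        intervalIntegral.integral_add, intervalIntegral.integral_const_mul,
        intervalIntegral.integral_const_mul, intervalIntegral.integral_const_mul,
        intervalIntegral.integral_const_mul, intervalIntegral_mul_conj_self, hparts, hb1, hb2',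
        hb3, hb4'] at hint
      · push_cast
        simp only [← Complex.mul_conj']
        linear_combination hint
      all_goals exact Continuous.intervalIntegrable (by fun_prop) _ _)
    hre hlt
  have hpos : 0 < ∫ s in (0 : ℝ)..1, ‖w0 s‖ ^ 2 :=
    intervalIntegral.integral_pos zero_lt_one (by fun_prop) (fun s _ => by positivity)
      ⟨s₀, hs₀, by positivity⟩
  exact hpos.ne' hzero

attribute [local instance] Matrix.linftyOpNormedRing Matrix.linftyOpNormedAlgebra

open NormedSpace in
theorem hasDerivAt_exp_smul_matrix (A : Matrix (Fin 4) (Fin 4) ℂ) (s : ℝ) :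
    HasDerivAt (fun t : ℝ => exp (t • A)) (A * exp (s • A)) s :=
  hasDerivAt_exp_smul_const' A s

theorem isUnit_det_exp (A : Matrix (Fin 4) (Fin 4) ℂ) : IsUnit (NormedSpace.exp A).det :=
  (Matrix.isUnit_iff_isUnit_det _).1 (Matrix.isUnit_exp A)

theorem HasDerivAt.matrix_mulVec {B : ℝ → Matrix (Fin 4) (Fin 4) ℂ} {B' : Matrix (Fin 4) (Fin 4) ℂ}
    {y : ℝ → Fin 4 → ℂ} {y' : Fin 4 → ℂ} {s : ℝ} (hB : HasDerivAt B B' s)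
    (hy : HasDerivAt y y' s) :
    HasDerivAt (fun t => (B t).mulVec (y t)) (B'.mulVec (y s) + (B s).mulVec y') s := by
  have hBij : ∀ i j, HasDerivAt (fun t => B t i j) (B' i j) s := by
    intro i j
    have hl : HasDerivAt (fun t => (Matrix.entryLinearMap ℝ ℂ i j).toContinuousLinearMap (B t))
      ((Matrix.entryLinearMap ℝ ℂ i j).toContinuousLinearMap B') s :=
      ContinuousLinearMap.hasFDerivAt _ |>.comp_hasDerivAt s hB
    exact hl
  rw [hasDerivAt_pi] at hy ⊢
  intro i
  simp only [Matrix.mulVec, dotProduct, Pi.add_apply, ← Finset.sum_add_distrib]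
  exact HasDerivAt.fun_sum fun j _ => (hBij i j).mul (hy j)

open NormedSpace in
theorem eq_exp_smul_mulVec {A : Matrix (Fin 4) (Fin 4) ℂ} {y : ℝ → Fin 4 → ℂ} {y' : ℝ → Fin 4 → ℂ}
    (hy : ∀ s, HasDerivAt y (y' s) s) (hode : ∀ s ∈ Set.Icc (0 : ℝ) 1, y' s = A.mulVec (y s)) :
    ∀ s ∈ Set.Icc (0 : ℝ) 1, y s = (exp (s • A)).mulVec (y 0) := by
  intro s hs
  have hd : ∀ t : ℝ, HasDerivAt (fun t : ℝ => (exp (t • (-A))).mulVec (y t))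
      ((exp (t • (-A)) * (-A)).mulVec (y t) + (exp (t • (-A))).mulVec (y' t)) t := fun t =>
    (hasDerivAt_exp_smul_const (-A) t).matrix_mulVec (hy t)
  have hconst := constant_of_has_deriv_right_zero (a := 0) (b := 1)
    (fun t _ => (hd t).continuousAt.continuousWithinAt)
    (fun t ht => by
      have h := (hd t).hasDerivWithinAt (s := Set.Ici t)
      rw [hode t ⟨ht.1, ht.2.le⟩, Matrix.mulVec_mulVec, ← Matrix.add_mulVec] at h
      simpa using h) s hs
  simp only [zero_smul, exp_zero, Matrix.one_mulVec] at hconst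
  rw [← hconst, Matrix.mulVec_mulVec, smul_neg, Matrix.exp_neg, Matrix.mul_nonsing_inv,
    Matrix.one_mulVec]
  exact isUnit_det_exp _

/-- The companion matrix of `w'''' = -(a * w'' + b * w' + c * w)`. -/
noncomputable def companion (a b c : ℂ) : Matrix (Fin 4) (Fin 4) ℂ :=
  !![0, 1, 0, 0; 0, 0, 1, 0; 0, 0, 0, 1; -c, -b, -a, 0]

section Characteristic

variable (α β η δ k01 k02 k03 k04 k11 k12 k13 k14 : ℝ)

/-- The matrix of the first order system equivalent to the differential equation. -/
noncomputable def systemMatrix (lam : ℂ) : Matrix (Fin 4) (Fin 4) ℂ :=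
  companion (η / (1 + α * lam)) (2 * lam * β * √η / (1 + α * lam))
    ((δ * lam + lam ^ 2) / (1 + α * lam))

/-- The boundary conditions at `0`, in the first two rows. -/
noncomputable def leftBoundary (lam : ℂ) : Matrix (Fin 4) (Fin 4) ℂ :=
  !![0, -(k01 + lam * k02), 1, 0; k03 + lam * k04, 0, 0, 1; 0, 0, 0, 0; 0, 0, 0, 0]

/-- The boundary conditions at `1`, in the last two rows. -/
noncomputable def rightBoundary (lam : ℂ) : Matrix (Fin 4) (Fin 4) ℂ :=
  !![0, 0, 0, 0; 0, 0, 0, 0; 0, k11 + lam * k12, 1, 0; -(k13 + lam * k14), 0, 0, 1]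

/-- The characteristic matrix of the boundary-eigenvalue problem. -/
noncomputable def charMatrix (lam : ℂ) : Matrix (Fin 4) (Fin 4) ℂ :=
  leftBoundary k01 k02 k03 k04 lam
    + rightBoundary k11 k12 k13 k14 lam * NormedSpace.exp (systemMatrix α β η δ lam)

variable {α β η δ k01 k02 k03 k04 k11 k12 k13 k14}

theorem det_charMatrix_eq_zero_of_isEigenvalue {lam : ℂ} (hlam : 1 + α * lam ≠ 0)
    (h : IsEigenvalue α β η δ k01 k02 k03 k04 k11 k12 k13 k14 lam) :
    (charMatrix α β η δ k01 k02 k03 k04 k11 k12 k13 k14 lam).det = 0 := by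
  obtain ⟨-, w, hw, ⟨s₀, hs₀, hne⟩, hode, hb1, hb2, hb3, hb4⟩ := h
  have hd : ∀ n : ℕ, n < 4 → ∀ s, HasDerivAt (iteratedDeriv n w) (iteratedDeriv (n + 1) w s) s := by
    intro n hn s
    rw [iteratedDeriv_succ]
    exact (hw.differentiable_iteratedDeriv n (by exact_mod_cast hn) s).hasDerivAt
  have hy : ∀ s, HasDerivAt (fun s (i : Fin 4) => iteratedDeriv i w s)
      (fun i => iteratedDeriv (i + 1) w s) s := fun s =>
    hasDerivAt_pi.2 fun i => hd i i.2 s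
  have hsol := eq_exp_smul_mulVec (A := systemMatrix α β η δ lam) hy (fun s hs => by
    funext i
    have h4 : iteratedDeriv 4 w s = -(η * iteratedDeriv 2 w s + 2 * lam * β * √η * deriv w s
        + (δ * lam + lam ^ 2) * w s) / (1 + α * lam) := by
      rw [eq_div_iff hlam]
      linear_combination hode s hs
    fin_cases i <;>
      simp [systemMatrix, companion, Matrix.mulVec, dotProduct, Fin.sum_univ_four]
    rw [h4]
    ring)
  rw [← Matrix.exists_mulVec_eq_zero_iff]
  refine ⟨fun i => iteratedDeriv i w 0, fun h0 => hne ?_, ?_⟩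
  · have := congrFun (hsol s₀ hs₀) 0
    rw [h0] at this
    simpa using this
  · have h1 := hsol 1 (by simp)
    rw [one_smul] at h1
    rw [charMatrix, Matrix.add_mulVec, ← Matrix.mulVec_mulVec, ← h1]
    funext i
    fin_cases i <;>
      simp [leftBoundary, rightBoundary, dotProduct, Fin.sum_univ_four, hb1, hb2, hb3, hb4] <;>
      ring

set_option maxHeartbeats 1000000 in
theorem isEigenvalue_of_det_charMatrix_eq_zero {lam : ℂ} (hlam : 1 + α * lam ≠ 0) (hα : α ≠ 0)
    (h : (charMatrix α β η δ k01 k02 k03 k04 k11 k12 k13 k14 lam).det = 0) :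
    IsEigenvalue α β η δ k01 k02 k03 k04 k11 k12 k13 k14 lam := by
  obtain ⟨c, hc, hbc⟩ := Matrix.exists_mulVec_eq_zero_iff.2 h
  set A := systemMatrix α β η δ lam with hA
  set y : ℝ → Fin 4 → ℂ := fun s => (NormedSpace.exp (s • A)).mulVec c with hydef
  have hy : ∀ s, HasDerivAt y (A.mulVec (y s)) s := by
    intro s
    have := (hasDerivAt_exp_smul_matrix A s).matrix_mulVec (hasDerivAt_const s c)
    simpa [hydef, Matrix.mulVec_mulVec] using this
  have hyi : ∀ i s, HasDerivAt (fun s => y s i) (A.mulVec (y s) i) s := fun i s =>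
    hasDerivAt_pi.1 (hy s) i
  have hd0 : deriv (fun s => y s 0) = fun s => y s 1 := funext fun s => by
    rw [(hyi 0 s).deriv]
    simp [hA, systemMatrix, companion, Matrix.mulVec, dotProduct, Fin.sum_univ_four]
  have hd1 : deriv (fun s => y s 1) = fun s => y s 2 := funext fun s => by
    rw [(hyi 1 s).deriv]
    simp [hA, systemMatrix, companion, Matrix.mulVec, dotProduct, Fin.sum_univ_four]
  have hd2 : deriv (fun s => y s 2) = fun s => y s 3 := funext fun s => by
    rw [(hyi 2 s).deriv]
    simp [hA, systemMatrix, companion, Matrix.mulVec, dotProduct, Fin.sum_univ_four]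
  have hd3 : deriv (fun s => y s 3) = fun s => A.mulVec (y s) 3 := funext fun s => (hyi 3 s).deriv
  have i1 : iteratedDeriv 1 (fun s => y s 0) = fun s => y s 1 := by
    rw [iteratedDeriv_one, hd0]
  have i2 : iteratedDeriv 2 (fun s => y s 0) = fun s => y s 2 := by
    rw [iteratedDeriv_succ, i1, hd1]
  have i3 : iteratedDeriv 3 (fun s => y s 0) = fun s => y s 3 := by
    rw [iteratedDeriv_succ, i2, hd2]
  have i4 : iteratedDeriv 4 (fun s => y s 0) = fun s => A.mulVec (y s) 3 := by
    rw [iteratedDeriv_succ, i3, hd3]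
  have hcont : ContDiff ℝ 4 (fun s => y s 0) := by
    have hexp : ContDiff ℝ 4 y := by
      have : ∀ n : ℕ, ContDiff ℝ n y := by
        intro n
        induction n with
        | zero =>
          exact contDiff_zero.2 (continuous_iff_continuousAt.2 fun s => (hy s).continuousAt)
        | succ n ih =>
          push_cast
          refine contDiff_succ_iff_deriv.2 ⟨fun s => (hy s).differentiableAt, by simp, ?_⟩
          rw [show deriv y = fun s => A.mulVec (y s) from funext fun s => (hy s).deriv]
          exact (Matrix.mulVecLin A |>.restrictScalars ℝ).toContinuousLinearMap.contDiff.comp ih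
      exact_mod_cast this 4
    exact contDiff_pi.1 hexp 0
  have hbdry : (leftBoundary k01 k02 k03 k04 lam).mulVec (y 0)
      + (rightBoundary k11 k12 k13 k14 lam).mulVec (y 1) = 0 := by
    rw [charMatrix, Matrix.add_mulVec, ← Matrix.mulVec_mulVec] at hbc
    simpa [hydef] using hbc
  refine ⟨?_, fun s => y s 0, hcont, ?_, ?_, ?_, ?_, ?_, ?_⟩
  · rintro rfl
    apply hlam
    have : (α : ℂ) ≠ 0 := by exact_mod_cast hα
    field_simp
    ring
  · by_contra! hzero
    have e0 : (fun s => y s 0) =ᶠ[nhds (1 / 2)] fun _ => 0 := by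
      filter_upwards [Icc_mem_nhds (a := (0 : ℝ)) (b := 1) (by norm_num) (by norm_num)] with s hs
      exact hzero s hs
    have e1 : (fun s => y s 1) =ᶠ[nhds (1 / 2)] fun _ => 0 := by
      simpa [hd0] using e0.deriv
    have e2 : (fun s => y s 2) =ᶠ[nhds (1 / 2)] fun _ => 0 := by
      simpa [hd1] using e1.deriv
    have e3 : (fun s => y s 3) =ᶠ[nhds (1 / 2)] fun _ => 0 := by
      simpa [hd2] using e2.deriv
    have hhalf : y (1 / 2) = 0 := by
      funext i
      fin_cases i
      · exact e0.eq_of_nhds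
      · exact e1.eq_of_nhds
      · exact e2.eq_of_nhds
      · exact e3.eq_of_nhds
    exact hc (Matrix.eq_zero_of_mulVec_eq_zero (isUnit_det_exp _).ne_zero hhalf)
  · intro s _
    rw [i4, i2, hd0]
    simp [hA, systemMatrix, companion, Matrix.mulVec, dotProduct, Fin.sum_univ_four]
    field_simp
    ring
  · rw [i2, hd0]
    have := congrFun hbdry 0
    simp [leftBoundary, rightBoundary, dotProduct, Fin.sum_univ_four] at this
    linear_combination this
  · rw [i3]
    have := congrFun hbdry 1
    simp [leftBoundary, rightBoundary, dotProduct, Fin.sum_univ_four] at this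
    linear_combination this
  · rw [i2, hd0]
    have := congrFun hbdry 2
    simp [leftBoundary, rightBoundary, dotProduct, Fin.sum_univ_four] at this
    linear_combination this
  · rw [i3]
    have := congrFun hbdry 3
    simp [leftBoundary, rightBoundary, dotProduct, Fin.sum_univ_four] at this
    linear_combination this

theorem differentiableAt_matrix {M : ℂ → Matrix (Fin 4) (Fin 4) ℂ} {z : ℂ}
    (h : ∀ i j, DifferentiableAt ℂ (fun w => M w i j) z) : DifferentiableAt ℂ M z := by
  have : M = fun w => ∑ i, ∑ j, M w i j • Matrix.single i j (1 : ℂ) := by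
    funext w
    conv_lhs => rw [Matrix.matrix_eq_sum_single (M w)]
    simp [Matrix.smul_single]
  rw [this]
  exact DifferentiableAt.fun_sum fun i _ => DifferentiableAt.fun_sum fun j _ =>
    (h i j).smul_const _

theorem DifferentiableAt.matrix_apply {M : ℂ → Matrix (Fin 4) (Fin 4) ℂ} {z : ℂ}
    (h : DifferentiableAt ℂ M z) (i j : Fin 4) : DifferentiableAt ℂ (fun w => M w i j) z :=
  ((Matrix.entryLinearMap ℂ ℂ i j).toContinuousLinearMap.differentiableAt).comp z h

theorem differentiableAt_det_charMatrix {lam : ℂ} (hlam : 1 + α * lam ≠ 0) :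
    DifferentiableAt ℂ
      (fun z => (charMatrix α β η δ k01 k02 k03 k04 k11 k12 k13 k14 z).det) lam := by
  have hsys : DifferentiableAt ℂ (systemMatrix α β η δ) lam := by
    refine differentiableAt_matrix fun i j => ?_
    fin_cases i <;> fin_cases j <;> simp [systemMatrix, companion] <;>
      fun_prop (disch := assumption)
  have hl : DifferentiableAt ℂ (leftBoundary k01 k02 k03 k04) lam := by
    refine differentiableAt_matrix fun i j => ?_
    fin_cases i <;> fin_cases j <;> simp [leftBoundary]
  have hr : DifferentiableAt ℂ (rightBoundary k11 k12 k13 k14) lam := by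
    refine differentiableAt_matrix fun i j => ?_
    fin_cases i <;> fin_cases j <;> simp [rightBoundary]
  have hexp : DifferentiableAt ℂ (fun z => NormedSpace.exp (systemMatrix α β η δ z)) lam :=
    (NormedSpace.exp_analytic (𝕂 := ℂ) _).differentiableAt.comp lam hsys
  have hM : DifferentiableAt ℂ (charMatrix α β η δ k01 k02 k03 k04 k11 k12 k13 k14) lam :=
    hl.add (hr.mul hexp)
  simp only [Matrix.det_apply]
  refine DifferentiableAt.fun_sum fun σ _ => DifferentiableAt.fun_const_smul ?_ _
  exact DifferentiableAt.fun_finsetProd fun i _ => hM.matrix_apply _ _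

end Characteristic

theorem one_add_mul_ne_zero_of_re {α : ℝ} {lam : ℂ} (hα : 0 < α) (h : -(1 / α) < lam.re) :
    1 + α * lam ≠ 0 := by
  intro h0
  have := congrArg Complex.re h0
  simp at this
  rw [← neg_div, div_lt_iff₀ hα] at h
  linarith

/-- when `η > 0`, at most finitely many eigenvalues of the generalised
boundary-eigenvalue problem lie in the open right half-plane. -/
theorem finitely_many_right_halfplane_eigenvalues (α β η δ k01 k02 k03 k04 k11 k12 k13 k14 : ℝ)
    (hα : 0 < α) (hβ0 : 0 < β) (hβ1 : β < 1) (hδ : 0 ≤ δ) (hη : 0 < η)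
    (h01 : 0 < k01) (h02 : 0 < k02) (h03 : 0 < k03) (h04 : 0 < k04)
    (h11 : 0 < k11) (h12 : 0 < k12) (h13 : 0 < k13) (h14 : 0 < k14) :
    {lam : ℂ | IsEigenvalue α β η δ k01 k02 k03 k04 k11 k12 k13 k14 lam ∧
      0 < lam.re}.Finite := by
  obtain ⟨R, hR⟩ := exists_norm_le_of_isEigenvalue hα hβ0 hδ hη h01 h02.le h03.le h04.le h11.le
    h12.le h13.le h14.le
  have hα' : 0 < 1 / α := by positivity
  set U : Set ℂ := {z | -(1 / α) < z.re} with hU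
  set D : ℂ → ℂ := fun z => (charMatrix α β η δ k01 k02 k03 k04 k11 k12 k13 k14 z).det with hD
  have hUopen : IsOpen U := isOpen_lt continuous_const Complex.continuous_re
  have hUconn : IsPreconnected U := (convex_halfSpace_re_gt _).isPreconnected
  have hDan : AnalyticOnNhd ℂ D U := DifferentiableOn.analyticOnNhd (fun z hz =>
    (differentiableAt_det_charMatrix (one_add_mul_ne_zero_of_re hα hz)).differentiableWithinAt)
    hUopen
  by_contra hinf
  have hsub : {lam : ℂ | IsEigenvalue α β η δ k01 k02 k03 k04 k11 k12 k13 k14 lam ∧ 0 < lam.re} ⊆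
      Metric.closedBall 0 R ∩ {z | 0 ≤ z.re} := fun z hz =>
    ⟨by simpa using hR z hz.1 hz.2, hz.2.le⟩
  have hcomp : IsCompact (Metric.closedBall (0 : ℂ) R ∩ {z | 0 ≤ z.re}) :=
    (isCompact_closedBall 0 R).inter_right (isClosed_le continuous_const Complex.continuous_re)
  obtain ⟨z₀, hz₀, hacc⟩ := Set.Infinite.exists_accPt_of_subset_isCompact hinf hcomp hsub
  have hzU : ∀ z : ℂ, 0 ≤ z.re → z ∈ U := fun z hz => by
    rw [hU, Set.mem_ofPred_eq]; linarith
  have hfreq : ∃ᶠ z in nhdsWithin z₀ {z₀}ᶜ, D z = 0 :=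
    (accPt_iff_frequently_nhdsNE.1 hacc).mono fun z hz =>
      det_charMatrix_eq_zero_of_isEigenvalue
        (one_add_mul_ne_zero_of_re hα (hzU z hz.2.le)) hz.1
  have hzero := hDan.eqOn_zero_of_preconnected_of_frequently_eq_zero hUconn (hzU z₀ hz₀.2) hfreq
  have hpos : 0 < |R| + 1 := by positivity
  have hmem : ((|R| + 1 : ℝ) : ℂ) ∈ U := hzU _ (by rw [Complex.ofReal_re]; exact hpos.le)
  have hle := hR _ (isEigenvalue_of_det_charMatrix_eq_zero
    (one_add_mul_ne_zero_of_re hα hmem) hα.ne' (hzero hmem)) (by rwa [Complex.ofReal_re])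
  rw [Complex.norm_of_nonneg hpos.le] at hle
  linarith [le_abs_self R]
end
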